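/- Assume m ≥ 2. Then: (i) there is an absolute constant C > 0 such that Σ_{j=1}^m |b_j| ≤ C·log m and r_j ≤ C·max{m³, m²·t/s}/j² for all j ∈ {1,…,m}; (ii) max_{1≤j≤m} s_j ≤ s; and (iii) for every function f : ℝ → ℝ that can be written as f(x) = P(x) + R(x) at the points x ∈ {0, s_1, …, s_m}, where P is a real polynomial of degree at most m−1 and R(0) = 0, the m-term Richardson estimator F = Σ_{j=1}^m b_j·f(s_j) satisfies |F − f(0)| ≤ (Σ_{j=1}^m |b_j|) · max_{1≤j≤m} |R(s_j)|. -/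

import Mathlib

/-- `K = max{m/π, 2t/s}`. -/
noncomputable def Kval (m : ℕ) (t s : ℝ) : ℝ := max ((m : ℝ) / Real.pi) (2 * t / s)

/-- `r_j = ⌈K / sin²(π(2j−1)/(8m))⌉` for `j ∈ {1,…,m}`. -/
noncomputable def rval (m : ℕ) (t s : ℝ) (j : ℕ) : ℕ :=
  ⌈Kval m t s / Real.sin (Real.pi * (2 * (j : ℝ) - 1) / (8 * (m : ℝ))) ^ 2⌉₊

/-- The sample point `s_j = t / r_j`. -/
noncomputable def sval (m : ℕ) (t s : ℝ) (j : ℕ) : ℝ := t / (rval m t s j : ℝ)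

/-- The Richardson coefficient `b_j = ∏_{ℓ ∈ {1,…,m}, ℓ≠j} 1/(1 − r_ℓ/r_j)`. -/
noncomputable def bval (m : ℕ) (t s : ℝ) (j : ℕ) : ℝ :=
  ∏ l ∈ (Finset.Icc 1 m).erase j, (1 - (rval m t s l : ℝ) / (rval m t s j : ℝ))⁻¹
open Real in
lemma gap_sin {u v : ℝ} (hu : 0 < u) (huv : u < v) (hv : v ≤ π / 4) :
    4 * (v - u) ≤ 1 / sin u ^ 2 - 1 / sin v ^ 2 := by
  have hpi := Real.pi_pos
  have hsu : 0 < sin u := sin_pos_of_pos_of_lt_pi hu (by linarith)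
  have hsv : 0 < sin v := sin_pos_of_pos_of_lt_pi (by linarith) (by linarith)
  have key : ∀ w, 0 < w → w ≤ π / 4 → sin w ≤ cos w := by
    intro w hw hw'
    rw [← sin_pi_div_two_sub]
    exact sin_le_sin_of_le_of_le_pi_div_two (by linarith) (by linarith) (by linarith)
  have h1 := key u hu (by linarith)
  have h2 := key v (by linarith) hv
  have hadd : 2 * (sin u * sin v) ≤ sin (u + v) := by
    rw [sin_add]; nlinarith
  have hd : 2 * (v - u) * (sin u * sin v) ≤ sin (v - u) := by
    have e1 : 2 * (sin u * sin v) = cos (v - u) - cos (u + v) := by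
      rw [cos_sub, cos_add]; ring
    have e2 : sin (v - u) ≤ cos (u + v) := by
      rw [← sin_pi_div_two_sub]
      exact sin_le_sin_of_le_of_le_pi_div_two (by linarith) (by linarith) (by linarith)
    have hc : 0 < cos (v - u) := cos_pos_of_mem_Ioo ⟨by linarith, by linarith⟩
    have e3 := Real.lt_tan (x := v - u) (by linarith) (by linarith)
    rw [tan_eq_sin_div_cos, lt_div_iff₀ hc] at e3
    have hs0 : 0 < sin (v - u) := sin_pos_of_pos_of_lt_pi (by linarith) (by linarith)
    have : (v - u) * cos (u + v) ≥ 0 := mul_nonneg (by linarith) (by linarith)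
    nlinarith
  have e : 1 / sin u ^ 2 - 1 / sin v ^ 2 = sin (v - u) * sin (u + v) / (sin u ^ 2 * sin v ^ 2) := by
    field_simp
    rw [sin_sub, sin_add]
    have a1 := sin_sq_add_cos_sq u
    have a2 := sin_sq_add_cos_sq v
    have a3 : cos u ^ 2 = 1 - sin u ^ 2 := by linarith
    have a4 : cos v ^ 2 = 1 - sin v ^ 2 := by linarith
    ring_nf
    rw [a3, a4]; ring
  rw [e, le_div_iff₀ (by positivity)]
  have := mul_le_mul hd hadd (by positivity) (by
    exact le_trans (mul_nonneg (by linarith) (by positivity)) hd)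
  nlinarith

open Real in
lemma gap_sin2 {u v : ℝ} (hu : 0 < u) (huv : u < v) (hv : v ≤ π / 4) :
    2 / π * (v - u) / sin u ^ 2 ≤ 1 / sin u ^ 2 - 1 / sin v ^ 2 ∧
    2 / π * (v - u) / sin v ^ 2 ≤ 1 / sin u ^ 2 - 1 / sin v ^ 2 := by
  have hpi := Real.pi_pos
  have hsu : 0 < sin u := sin_pos_of_pos_of_lt_pi hu (by linarith)
  have hsv : 0 < sin v := sin_pos_of_pos_of_lt_pi (by linarith) (by linarith)
  have e : 1 / sin u ^ 2 - 1 / sin v ^ 2 = sin (v - u) * sin (u + v) / (sin u ^ 2 * sin v ^ 2) := by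
    field_simp
    rw [sin_sub, sin_add]
    have a1 := sin_sq_add_cos_sq u
    have a2 := sin_sq_add_cos_sq v
    have a3 : cos u ^ 2 = 1 - sin u ^ 2 := by linarith
    have a4 : cos v ^ 2 = 1 - sin v ^ 2 := by linarith
    ring_nf
    rw [a3, a4]; ring
  have hd := mul_le_sin (x := v - u) (by linarith) (by linarith)
  have hd0 : 0 ≤ 2 / π * (v - u) := mul_nonneg (by positivity) (by linarith)
  have b1 : sin v ≤ sin (u + v) :=
    sin_le_sin_of_le_of_le_pi_div_two (by linarith) (by linarith) (by linarith)
  have b2 : sin u ≤ sin (u + v) :=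
    sin_le_sin_of_le_of_le_pi_div_two (by linarith) (by linarith) (by linarith)
  have c1 := sin_le_one u
  have c2 := sin_le_one v
  rw [e]
  constructor
  · rw [div_le_div_iff₀ (by positivity) (by positivity)]
    have : 2 / π * (v - u) * sin v ^ 2 ≤ sin (v - u) * sin (u + v) :=
      mul_le_mul hd (by nlinarith) (by positivity) (by linarith)
    nlinarith [mul_le_mul_of_nonneg_right this (sq_nonneg (sin u))]
  · rw [div_le_div_iff₀ (by positivity) (by positivity)]
    have : 2 / π * (v - u) * sin u ^ 2 ≤ sin (v - u) * sin (u + v) :=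
      mul_le_mul hd (by nlinarith) (by positivity) (by linarith)
    nlinarith [mul_le_mul_of_nonneg_right this (sq_nonneg (sin v))]

noncomputable def th (m j : ℕ) : ℝ := Real.pi * (2 * (j : ℝ) - 1) / (8 * (m : ℝ))

noncomputable def xx (m j : ℕ) : ℝ := Real.sin (th m j) ^ 2

noncomputable def aa (m : ℕ) (t s : ℝ) (j : ℕ) : ℝ := Kval m t s / xx m j

lemma rval_eq (m : ℕ) (t s : ℝ) (j : ℕ) : rval m t s j = ⌈aa m t s j⌉₊ := rfl

lemma th_bounds {m j : ℕ} (hj : j ∈ Finset.Icc 1 m) :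
    0 < th m j ∧ th m j < Real.pi / 4 := by
  rw [Finset.mem_Icc] at hj
  have h1 : (1:ℝ) ≤ j := by exact_mod_cast hj.1
  have h2 : (j:ℝ) ≤ m := by exact_mod_cast hj.2
  have hpi := Real.pi_pos
  unfold th
  constructor
  · apply div_pos (mul_pos hpi (by linarith)) (by linarith)
  · rw [div_lt_div_iff₀ (by linarith) (by norm_num)]
    nlinarith

lemma th_sub {m : ℕ} (hm : 0 < m) (j l : ℕ) :
    th m l - th m j = Real.pi / (4 * m) * ((l:ℝ) - j) := by
  have : (0:ℝ) < m := by exact_mod_cast hm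
  unfold th; field_simp; ring

lemma xx_bounds {m j : ℕ} (hj : j ∈ Finset.Icc 1 m) : 0 < xx m j ∧ xx m j ≤ 1 / 2 := by
  obtain ⟨h0, h1⟩ := th_bounds hj
  have hpi := Real.pi_pos
  have := Real.sin_pos_of_pos_of_lt_pi h0 (by linarith)
  unfold xx
  refine ⟨by positivity, ?_⟩
  have hc : 0 < Real.cos (2 * th m j) := Real.cos_pos_of_mem_Ioo ⟨by linarith, by linarith⟩
  rw [Real.cos_two_mul] at hc
  have := Real.sin_sq_add_cos_sq (th m j)
  linarith

lemma K_ge (m : ℕ) (t s : ℝ) : (m:ℝ) / Real.pi ≤ Kval m t s := le_max_left _ _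

lemma aa_gap {m : ℕ} {t s : ℝ} {j l : ℕ} (hj : j ∈ Finset.Icc 1 m) (hl : l ∈ Finset.Icc 1 m)
    (hjl : j < l) : aa m t s l + 1 ≤ aa m t s j ∧
      ((l:ℝ) - j) / (2 * Real.pi * xx m j) ≤ aa m t s j - aa m t s l ∧
      ((l:ℝ) - j) / (2 * Real.pi * xx m l) ≤ aa m t s j - aa m t s l := by
  have hm : 0 < m := by rw [Finset.mem_Icc] at hj; omega
  have hm' : (0:ℝ) < m := by exact_mod_cast hm
  have hpi := Real.pi_pos
  have hd := th_sub hm j l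
  have hlj : (1:ℝ) ≤ (l:ℝ) - j := by
    have : (j:ℝ) + 1 ≤ l := by exact_mod_cast hjl
    linarith
  have hlt : th m j < th m l := by
    have : 0 < th m l - th m j := by rw [hd]; positivity
    linarith
  obtain ⟨hj0, hj1⟩ := th_bounds hj
  obtain ⟨hl0, hl1⟩ := th_bounds hl
  have g1 := gap_sin hj0 hlt hl1.le
  have ⟨g2, g3⟩ := gap_sin2 hj0 hlt hl1.le
  have hK := K_ge m t s
  have hx := (xx_bounds hj).1
  have hy := (xx_bounds hl).1
  have e : aa m t s j - aa m t s l = Kval m t s * (1 / xx m j - 1 / xx m l) := by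
    unfold aa; ring
  rw [hd] at g1 g2 g3
  change _ ≤ 1 / xx m j - 1 / xx m l at g1
  change _ / xx m j ≤ 1 / xx m j - 1 / xx m l at g2
  change _ / xx m l ≤ 1 / xx m j - 1 / xx m l at g3
  have hmp : 0 < (m:ℝ) / Real.pi := by positivity
  have hg0 : 0 ≤ 1 / xx m j - 1 / xx m l := le_trans (by positivity) g1
  have hstep : (m:ℝ) / Real.pi * (1 / xx m j - 1 / xx m l) ≤ aa m t s j - aa m t s l := by
    rw [e]; exact mul_le_mul_of_nonneg_right hK hg0
  refine ⟨?_, le_trans ?_ hstep, le_trans ?_ hstep⟩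
  · have := mul_le_mul_of_nonneg_left g1 hmp.le
    have e2 : (m:ℝ) / Real.pi * (4 * (Real.pi / (4 * m) * ((l:ℝ) - j))) = (l:ℝ) - j := by
      field_simp
    linarith
  · refine le_trans (le_of_eq ?_) (mul_le_mul_of_nonneg_left g2 hmp.le)
    field_simp; ring
  · refine le_trans (le_of_eq ?_) (mul_le_mul_of_nonneg_left g3 hmp.le)
    field_simp; ring

lemma aa_pos {m : ℕ} {t s : ℝ} {j : ℕ} (hj : j ∈ Finset.Icc 1 m) : 0 < aa m t s j := by
  have hm : 0 < m := by rw [Finset.mem_Icc] at hj; omega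
  have hm' : (0:ℝ) < m := by exact_mod_cast hm
  have hpi := Real.pi_pos
  exact div_pos (lt_of_lt_of_le (by positivity) (K_ge m t s)) (xx_bounds hj).1

lemma rval_lb {m : ℕ} (t s : ℝ) (j : ℕ) : aa m t s j ≤ rval m t s j := Nat.le_ceil _

lemma rval_ub {m : ℕ} {t s : ℝ} {j : ℕ} (hj : j ∈ Finset.Icc 1 m) :
    (rval m t s j : ℝ) < aa m t s j + 1 := Nat.ceil_lt_add_one (aa_pos hj).le

lemma rval_gap {m : ℕ} {t s : ℝ} {j l : ℕ} (hj : j ∈ Finset.Icc 1 m) (hl : l ∈ Finset.Icc 1 m)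
    (hjl : j < l) : (rval m t s l : ℝ) + 1 ≤ rval m t s j := by
  have h := (aa_gap (t := t) (s := s) hj hl hjl).1
  have : ⌈aa m t s l + 1⌉₊ ≤ ⌈aa m t s j⌉₊ := Nat.ceil_mono h
  rw [Nat.ceil_add_one (aa_pos hl).le] at this
  rw [rval_eq, rval_eq]
  exact_mod_cast this

/-- symmetric facts for distinct indices -/
lemma sym_gap {m : ℕ} {t s : ℝ} {j l : ℕ} (hj : j ∈ Finset.Icc 1 m) (hl : l ∈ Finset.Icc 1 m)
    (hjl : l ≠ j) : 1 ≤ |(rval m t s j : ℝ) - rval m t s l| ∧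
      |aa m t s j - aa m t s l| ≤ |(rval m t s j : ℝ) - rval m t s l| + 1 ∧
      0 < |aa m t s j - aa m t s l| ∧
      1 / |(rval m t s j : ℝ) - rval m t s l| ≤ 4 * Real.pi * xx m j / |(l:ℝ) - j| := by
  have hpi := Real.pi_pos
  have hx := (xx_bounds hj).1
  have l1 := rval_lb (m := m) t s j
  have l2 := rval_lb (m := m) t s l
  have u1 := rval_ub (t := t) (s := s) hj
  have u2 := rval_ub (t := t) (s := s) hl
  have fin : ∀ R A D : ℝ, 0 < D → 1 ≤ R → A ≤ R + 1 → D / (2 * Real.pi * xx m j) ≤ A →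
      1 / R ≤ 4 * Real.pi * xx m j / D := by
    intro R A D hD h1 h2 h3
    rw [div_le_div_iff₀ (by linarith) hD]
    rw [div_le_iff₀ (by positivity)] at h3
    have : 0 < Real.pi * xx m j := by positivity
    nlinarith
  rcases lt_or_gt_of_ne hjl with h | h
  · have hg := rval_gap (t := t) (s := s) hl hj h
    obtain ⟨g1, g2, g3⟩ := aa_gap (t := t) (s := s) hl hj h
    have hc : (l:ℝ) < j := by exact_mod_cast h
    rw [abs_sub_comm (rval m t s j : ℝ), abs_sub_comm (aa m t s j), abs_sub_comm (l:ℝ)]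
    rw [abs_of_pos (show 0 < (rval m t s l : ℝ) - rval m t s j by linarith),
      abs_of_pos (show 0 < aa m t s l - aa m t s j by linarith),
      abs_of_pos (show 0 < (j:ℝ) - l by linarith)]
    exact ⟨by linarith, by linarith, by linarith,
      fin _ _ _ (by linarith) (by linarith) (by linarith) g3⟩
  · have hg := rval_gap (t := t) (s := s) hj hl h
    obtain ⟨g1, g2, g3⟩ := aa_gap (t := t) (s := s) hj hl h
    have hc : (j:ℝ) < l := by exact_mod_cast h
    rw [abs_of_pos (show 0 < (rval m t s j : ℝ) - rval m t s l by linarith),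
      abs_of_pos (show 0 < aa m t s j - aa m t s l by linarith),
      abs_of_pos (show 0 < (l:ℝ) - j by linarith)]
    exact ⟨by linarith, by linarith, by linarith,
      fin _ _ _ (by linarith) (by linarith) (by linarith) g2⟩

lemma rval_pos {m : ℕ} {t s : ℝ} {j : ℕ} (hj : j ∈ Finset.Icc 1 m) :
    (0:ℝ) < rval m t s j := lt_of_lt_of_le (aa_pos hj) (rval_lb t s j)

/-- part (ii) -/
lemma part_ii {m : ℕ} {t s : ℝ} (ht : 0 < t) (hs : 0 < s) {j : ℕ} (hj : j ∈ Finset.Icc 1 m) :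
    sval m t s j ≤ s := by
  unfold sval
  rw [div_le_iff₀ (rval_pos hj)]
  have h1 := rval_lb (m := m) t s j
  obtain ⟨h2, h3⟩ := xx_bounds hj
  have h4 : 2 * t / s ≤ Kval m t s := le_max_right _ _
  rw [div_le_iff₀ hs] at h4
  have h5 : Kval m t s = aa m t s j * xx m j := by unfold aa; field_simp
  have h6 := aa_pos (t := t) (s := s) hj
  have h7 : aa m t s j * xx m j * s ≤ aa m t s j * s := by
    have : aa m t s j * xx m j ≤ aa m t s j := by nlinarith
    exact mul_le_mul_of_nonneg_right this hs.le
  rw [h5] at h4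
  nlinarith

lemma part_r {m : ℕ} {t s : ℝ} (ht : 0 < t) (hs : 0 < s) {j : ℕ} (hj : j ∈ Finset.Icc 1 m) :
    (rval m t s j : ℝ) ≤ 33 * max ((m:ℝ)^3) ((m:ℝ)^2 * t / s) / (j:ℝ)^2 := by
  have hpi := Real.pi_pos
  obtain ⟨h0, h1⟩ := th_bounds hj
  have hj' := hj
  rw [Finset.mem_Icc] at hj
  have hj1 : (1:ℝ) ≤ j := by exact_mod_cast hj.1
  have hj2 : (j:ℝ) ≤ m := by exact_mod_cast hj.2
  have hsin : (j:ℝ) / (4 * m) ≤ Real.sin (th m j) := by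
    refine le_trans ?_ (Real.mul_le_sin h0.le (by linarith))
    unfold th
    have : 2 / Real.pi * (Real.pi * (2 * (j:ℝ) - 1) / (8 * m)) = (2 * j - 1) / (4 * m) := by
      field_simp; ring
    rw [this]
    gcongr; linarith
  have hx : ((j:ℝ) / (4 * m)) ^ 2 ≤ xx m j := by
    unfold xx; gcongr
  set M := max ((m:ℝ)^3) ((m:ℝ)^2 * t / s) with hM
  have hM1 : (m:ℝ)^3 ≤ M := le_max_left _ _
  have hM2 : (m:ℝ)^2 * t / s ≤ M := le_max_right _ _
  have hm0 : (0:ℝ) < m := by linarith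
  have hK : (m:ℝ)^2 * Kval m t s ≤ 2 * M := by
    unfold Kval
    rw [mul_max_of_nonneg _ _ (by positivity)]
    apply max_le
    · have : (m:ℝ) / Real.pi ≤ m := div_le_self hm0.le (by linarith [Real.pi_gt_three])
      have h3 : (m:ℝ)^2 * (m / Real.pi) ≤ m^2 * m := by gcongr
      have : 0 < (m:ℝ)^3 := by positivity
      nlinarith
    · have : (m:ℝ)^2 * (2 * t / s) = 2 * ((m:ℝ)^2 * t / s) := by ring
      linarith
  have hub := rval_ub (t := t) (s := s) hj'
  have hx0 := (xx_bounds hj').1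
  have hKp : 0 < Kval m t s := lt_of_lt_of_le (by positivity) (K_ge m t s)
  have ha : aa m t s j * (j:ℝ)^2 ≤ 32 * M := by
    have e1 : aa m t s j ≤ Kval m t s / ((j:ℝ) / (4 * m)) ^ 2 := by
      unfold aa; gcongr
    have e2 : Kval m t s / ((j:ℝ) / (4 * m)) ^ 2 * (j:ℝ)^2 = 16 * ((m:ℝ)^2 * Kval m t s) := by
      field_simp; ring
    have := mul_le_mul_of_nonneg_right e1 (sq_nonneg (j:ℝ))
    linarith
  rw [le_div_iff₀ (by positivity)]
  have hj3 : (j:ℝ)^2 ≤ M := by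
    have : (j:ℝ)^2 ≤ m^2 := by gcongr
    have : (m:ℝ)^2 ≤ m^3 := by
      have : (1:ℝ) ≤ m := by linarith
      nlinarith [sq_nonneg (m:ℝ)]
    linarith
  have := mul_le_mul_of_nonneg_right hub.le (sq_nonneg (j:ℝ))
  linarith

lemma sval_injOn {m : ℕ} {t s : ℝ} (ht : 0 < t) :
    Set.InjOn (sval m t s) (Finset.Icc 1 m : Finset ℕ) := by
  intro j hj l hl h
  by_contra hne
  have h1 := (sym_gap (t := t) (s := s) hj hl (fun h => hne h.symm)).1
  have p1 := rval_pos (t := t) (s := s) hj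
  have p2 := rval_pos (t := t) (s := s) hl
  unfold sval at h
  rw [div_eq_div_iff p1.ne' p2.ne'] at h
  have := mul_left_cancel₀ ht.ne' h
  rw [this, sub_self, abs_zero] at h1
  linarith

lemma part_iii {m : ℕ} (hm : 2 ≤ m) {t s : ℝ} (ht : 0 < t) (f R : ℝ → ℝ) (P : Polynomial ℝ)
    (hP : P.natDegree ≤ m - 1) (hR : R 0 = 0)
    (hf0 : f 0 = Polynomial.eval 0 P + R 0)
    (hf : ∀ j ∈ Finset.Icc 1 m,
          f (sval m t s j) = Polynomial.eval (sval m t s j) P + R (sval m t s j)) :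
    |(∑ j ∈ Finset.Icc 1 m, bval m t s j * f (sval m t s j)) - f 0|
          ≤ (∑ j ∈ Finset.Icc 1 m, |bval m t s j|) *
            (Finset.Icc 1 m).sup' (Finset.nonempty_Icc.mpr (le_trans one_le_two hm))
              (fun j => |R (sval m t s j)|) := by
  have hdeg : P.degree < (Finset.Icc 1 m).card := by
    refine lt_of_le_of_lt Polynomial.degree_le_natDegree ?_
    rw [Nat.card_Icc]
    have : P.natDegree < m + 1 - 1 := by omega
    exact_mod_cast this
  have hI := Lagrange.eq_interpolate (sval_injOn (m := m) (s := s) ht) hdeg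
  have hsum : ∑ j ∈ Finset.Icc 1 m, bval m t s j * P.eval (sval m t s j) = P.eval 0 := by
    conv_rhs => rw [hI]
    rw [Lagrange.interpolate_apply, Polynomial.eval_finsetSum]
    refine Finset.sum_congr rfl fun j hj => ?_
    rw [Polynomial.eval_mul, Polynomial.eval_C, mul_comm]
    congr 1
    unfold bval Lagrange.basis
    rw [Polynomial.eval_prod]
    refine Finset.prod_congr rfl fun l hl => ?_
    rw [Finset.mem_erase] at hl
    have p1 := rval_pos (t := t) (s := s) hj
    have p2 := rval_pos (t := t) (s := s) hl.2
    have hne : (rval m t s j : ℝ) - rval m t s l ≠ 0 := by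
      intro h
      have := (sym_gap (t := t) (s := s) hj hl.2 hl.1).1
      rw [h, abs_zero] at this; linarith
    have hne' : (rval m t s l : ℝ) - rval m t s j ≠ 0 := by
      intro h; apply hne; linarith
    simp only [Lagrange.basisDivisor, Polynomial.eval_mul, Polynomial.eval_C,
      Polynomial.eval_sub, Polynomial.eval_X, sval]
    have e1 : 1 - (rval m t s l : ℝ) / rval m t s j
      = (rval m t s j - rval m t s l) / rval m t s j := by field_simp
    have e2 : t / (rval m t s j : ℝ) - t / rval m t s l
      = t * (rval m t s l - rval m t s j) / (rval m t s j * rval m t s l) := by field_simp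
    rw [e1, e2]
    field_simp
    ring
  have e : (∑ j ∈ Finset.Icc 1 m, bval m t s j * f (sval m t s j)) - f 0
      = ∑ j ∈ Finset.Icc 1 m, bval m t s j * R (sval m t s j) := by
    rw [hf0, hR, ← hsum, add_zero, ← Finset.sum_sub_distrib]
    refine Finset.sum_congr rfl fun j hj => ?_
    rw [hf j hj]; ring
  rw [e, Finset.sum_mul]
  refine (Finset.abs_sum_le_sum_abs _ _).trans (Finset.sum_le_sum fun j hj => ?_)
  rw [abs_mul]
  exact mul_le_mul_of_nonneg_left
    (Finset.le_sup' (fun j => |R (sval m t s j)|) hj) (abs_nonneg _)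

noncomputable def XX (m j : ℕ) : ℝ := Real.cos (4 * th m j)

lemma XX_eq (m j : ℕ) : XX m j = 1 - 8 * xx m j * (1 - xx m j) := by
  unfold XX xx
  have h : 4 * th m j = 2 * (2 * th m j) := by ring
  rw [h, Real.cos_two_mul, Real.cos_two_mul, Real.cos_sq']
  ring

lemma XX_injOn (m : ℕ) : Set.InjOn (XX m) (Finset.Icc 1 m : Finset ℕ) := by
  intro j hj l hl h
  have hj' : j ∈ Finset.Icc 1 m := hj
  obtain ⟨a1, a2⟩ := th_bounds hj
  obtain ⟨b1, b2⟩ := th_bounds hl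
  have hm : 0 < m := by rw [Finset.mem_Icc] at hj'; omega
  have e := Real.injOn_cos (x₁ := 4 * th m j) (x₂ := 4 * th m l)
    ⟨by linarith, by linarith⟩ ⟨by linarith, by linarith⟩ h
  have hd := th_sub hm j l
  have h0 : th m l - th m j = 0 := by linarith
  rw [h0] at hd
  have hpi := Real.pi_pos
  have hm' : (0:ℝ) < m := by exact_mod_cast hm
  have : (l:ℝ) - j = 0 := by
    rcases mul_eq_zero.mp hd.symm with h | h
    · have : Real.pi / (4 * m) ≠ 0 := by positivity
      exact absurd h this
    · exact h
  have : (j:ℝ) = l := by linarith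
  exact_mod_cast this

open Polynomial Polynomial.Chebyshev in
lemma T_factor {m : ℕ} (hm : 0 < m) :
    T ℝ m = C (T ℝ m).leadingCoeff * Lagrange.nodal (Finset.Icc 1 m) (XX m) := by
  have hm' : (0:ℝ) < m := by exact_mod_cast hm
  have hinj := XX_injOn m
  have hcard : ((Finset.Icc 1 m).image (XX m)).card = m := by
    rw [Finset.card_image_of_injOn hinj]; simp
  have hdeg : (T ℝ m).degree = m := by rw [degree_T]; simp
  have hroots : (T ℝ m).roots = ((Finset.Icc 1 m).image (XX m)).val := by
    refine roots_eq_of_degree_eq_card (fun x hx ↦ ?_) ?_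
    · obtain ⟨k, hk, rfl⟩ := Finset.mem_image.mp hx
      unfold XX
      rw [T_real_cos, Real.cos_eq_zero_iff]
      refine ⟨(k:ℤ) - 1, ?_⟩
      unfold th
      push_cast
      field_simp
      ring
    · rw [hcard, hdeg]
  have hc : Multiset.card (T ℝ m).roots = (T ℝ m).natDegree := by
    rw [hroots, Finset.card_val, hcard, natDegree_eq_of_degree_eq_some hdeg]
  have := C_leadingCoeff_mul_prod_multiset_X_sub_C hc
  rw [hroots] at this
  conv_lhs => rw [← this]
  congr 1
  rw [Lagrange.nodal, ← Finset.prod_image (f := fun x => X - C x) hinj]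
  rfl

open Polynomial Polynomial.Chebyshev in
lemma cheb_prod {m j : ℕ} (hj : j ∈ Finset.Icc 1 m) :
    ∏ l ∈ (Finset.Icc 1 m).erase j, ((1 - XX m l) / |XX m j - XX m l|) ≤ 2 / j := by
  have hpi := Real.pi_pos
  have hm : 0 < m := by rw [Finset.mem_Icc] at hj; omega
  have hj1 : (1:ℝ) ≤ j := by rw [Finset.mem_Icc] at hj; exact_mod_cast hj.1
  have hm' : (0:ℝ) < m := by exact_mod_cast hm
  obtain ⟨h0, h1⟩ := th_bounds hj
  set c := (T ℝ m).leadingCoeff with hc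
  have hT := T_factor hm
  rw [← hc] at hT
  have hE1 : (1:ℝ) = c * ((1 - XX m j) * ∏ l ∈ (Finset.Icc 1 m).erase j, (1 - XX m l)) := by
    have := congrArg (eval 1) hT
    rw [T_eval_one, eval_mul, eval_C, Lagrange.eval_nodal] at this
    rw [Finset.mul_prod_erase _ (fun l => 1 - XX m l) hj]
    exact this
  have hsin : 0 < Real.sin (4 * th m j) :=
    Real.sin_pos_of_pos_of_lt_pi (by linarith) (by linarith)
  have hE2 : |c * ∏ l ∈ (Finset.Icc 1 m).erase j, (XX m j - XX m l)| * Real.sin (4 * th m j)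
      = m := by
    have := congrArg (fun p => eval (XX m j) (derivative p)) hT
    simp only [derivative_C_mul, eval_mul, eval_C] at this
    rw [Lagrange.eval_nodal_derivative_eval_node_eq hj, Lagrange.eval_nodal,
      T_derivative_eq_U] at this
    rw [← this]
    have hU := U_real_cos (4 * th m j) ((m:ℤ) - 1)
    rw [← abs_of_pos hsin, ← abs_mul, eval_mul]
    have e : eval (XX m j) (((m:ℤ):ℝ[X])) = m := by simp
    rw [e, mul_assoc]
    rw [show XX m j = Real.cos (4 * th m j) from rfl, hU, abs_mul]
    have e2 : |Real.sin ((((m:ℤ) - 1 : ℤ) + 1) * (4 * th m j))| = 1 := by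
      have hz : Real.cos ((((m:ℤ) - 1 : ℤ) + 1) * (4 * th m j)) = 0 := by
        rw [Real.cos_eq_zero_iff]
        refine ⟨(j:ℤ) - 1, ?_⟩
        unfold th
        push_cast
        field_simp
        ring
      have := Real.sin_sq_add_cos_sq ((((m:ℤ) - 1 : ℤ) + 1) * (4 * th m j))
      rw [hz] at this
      have h2 : Real.sin ((((m:ℤ) - 1 : ℤ) + 1) * (4 * th m j)) ^ 2 = 1 := by linarith
      rw [← sq_abs] at h2
      nlinarith [abs_nonneg (Real.sin ((((m:ℤ) - 1 : ℤ) + 1) * (4 * th m j)))]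
    rw [e2]
    simp
  rw [Finset.prod_div_distrib, ← Finset.abs_prod]
  set A := ∏ l ∈ (Finset.Icc 1 m).erase j, (1 - XX m l)
  set B := ∏ l ∈ (Finset.Icc 1 m).erase j, (XX m j - XX m l)
  have hA0 : 0 ≤ A := Finset.prod_nonneg fun l _ => by
    have := Real.cos_le_one (4 * th m l); unfold XX; linarith
  have hcne : c ≠ 0 := by
    intro h; rw [h] at hE1; simp at hE1
  have hcp : 0 < |c| := abs_pos.mpr hcne
  rw [abs_mul] at hE2
  have hX : XX m j = 1 - 2 * Real.sin (2 * th m j) ^ 2 := by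
    unfold XX
    rw [show 4 * th m j = 2 * (2 * th m j) by ring, Real.cos_two_mul, Real.cos_sq']; ring
  have hs2 : Real.sin (4 * th m j) = 2 * Real.sin (2 * th m j) * Real.cos (2 * th m j) := by
    rw [show 4 * th m j = 2 * (2 * th m j) by ring, Real.sin_two_mul]
  have hsp : 0 < Real.sin (2 * th m j) := Real.sin_pos_of_pos_of_lt_pi (by linarith) (by linarith)
  have hcp2 : 0 < Real.cos (2 * th m j) := Real.cos_pos_of_mem_Ioo ⟨by linarith, by linarith⟩
  have htan := Real.lt_tan (x := 2 * th m j) (by linarith) (by linarith)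
  rw [Real.tan_eq_sin_div_cos, lt_div_iff₀ hcp2] at htan
  set S := Real.sin (2 * th m j)
  set Q := Real.cos (2 * th m j)
  have hBp : 0 < |B| := by
    by_contra h
    have : |B| = 0 := le_antisymm (not_lt.mp h) (abs_nonneg _)
    rw [this] at hE2; simp at hE2; linarith
  have hE1' : 1 = |c| * (2 * S ^ 2 * A) := by
    have := congrArg abs hE1
    rw [abs_one, abs_mul, hX, abs_of_nonneg (mul_nonneg (by nlinarith) hA0)] at this
    rw [this]; ring
  have hth : (j:ℝ) * Real.pi / (8 * m) ≤ th m j := by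
    unfold th
    refine div_le_div_of_nonneg_right ?_ (by positivity)
    nlinarith
  rw [div_le_div_iff₀ hBp (by linarith)]
  rw [hs2] at hE2
  -- |c| |B| 2 S Q = m ; |c| 2 S^2 A = 1
  have k1 : A * (|c| * (2 * S ^ 2)) = 1 := by linarith
  have k2 : |B| * (|c| * (2 * S * Q)) = m := by linarith
  have k3 : (j:ℝ) * Q ≤ 2 * m * S := by
    have : (j:ℝ) * Real.pi / (8 * m) * 2 * Q ≤ S := by
      have := mul_le_mul_of_nonneg_right hth hcp2.le
      linarith
    have e : (j:ℝ) * Real.pi / (8 * m) * 2 * Q = (j * Q * Real.pi) / (4 * m) := by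
      field_simp; ring
    rw [e, div_le_iff₀ (by positivity)] at this
    have hp3 := Real.pi_gt_three
    have : 0 < (j:ℝ) * Q := by positivity
    nlinarith
  have pos : 0 < |c| * (2 * S ^ 2) * Q := by positivity
  refine le_of_mul_le_mul_right ?_ pos
  calc A * j * (|c| * (2 * S ^ 2) * Q) = (A * (|c| * (2 * S ^ 2))) * (j * Q) := by ring
    _ = j * Q := by rw [k1, one_mul]
    _ ≤ 2 * m * S := k3
    _ = 2 * (|B| * (|c| * (2 * S * Q))) * S := by rw [k2]
    _ = 2 * |B| * (|c| * (2 * S ^ 2) * Q) := by ring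

lemma factor_bound {m : ℕ} {t s : ℝ} {j l : ℕ} (hj : j ∈ Finset.Icc 1 m)
    (hl : l ∈ Finset.Icc 1 m) (hjl : l ≠ j) :
    |(1 - (rval m t s l : ℝ) / (rval m t s j : ℝ))⁻¹| ≤
      ((1 - XX m l) / |XX m j - XX m l|) *
        Real.exp (Real.pi / m + 4 * Real.pi * xx m j * (1 / |(l:ℝ) - j|) - xx m j) := by
  have hpi := Real.pi_pos
  have hm' : (0:ℝ) < m := by
    rw [Finset.mem_Icc] at hj; exact_mod_cast (by omega : 0 < m)
  obtain ⟨g1, g2, g3, g4⟩ := sym_gap (t := t) (s := s) hj hl hjl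
  have p1 := rval_pos (t := t) (s := s) hj
  have ub := rval_ub (t := t) (s := s) hj
  have ap := aa_pos (t := t) (s := s) hj
  obtain ⟨x0, x1⟩ := xx_bounds hj
  obtain ⟨y0, y1⟩ := xx_bounds hl
  have hK := K_ge m t s
  have hKp : 0 < Kval m t s := lt_of_lt_of_le (by positivity) hK
  have e1 : |(1 - (rval m t s l : ℝ) / (rval m t s j : ℝ))⁻¹|
      = rval m t s j / |(rval m t s j : ℝ) - rval m t s l| := by
    have : 1 - (rval m t s l : ℝ) / rval m t s j
      = (rval m t s j - rval m t s l) / rval m t s j := by field_simp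
    rw [this, inv_div, abs_div, abs_of_pos p1]
  have e2 : |aa m t s j - aa m t s l| = aa m t s j * |xx m l - xx m j| / xx m l := by
    have : aa m t s j - aa m t s l = aa m t s j * (xx m l - xx m j) / xx m l := by
      unfold aa; field_simp
    rw [this, abs_div, abs_mul, abs_of_pos ap, abs_of_pos y0]
  set R := |(rval m t s j : ℝ) - rval m t s l|
  set A := |aa m t s j - aa m t s l|
  have hRp : 0 < R := by linarith
  have hxne : xx m l - xx m j ≠ 0 := by
    intro h; rw [h] at e2; simp at e2; linarith
  have hxa : 0 < |xx m l - xx m j| := abs_pos.mpr hxne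
  have hsum : 0 < 1 - xx m j - xx m l := by
    rcases lt_or_gt_of_ne hxne with h | h <;> linarith
  have hG : (1 - XX m l) / |XX m j - XX m l|
      = xx m l * (1 - xx m l) / (|xx m l - xx m j| * (1 - xx m j - xx m l)) := by
    have q : XX m j - XX m l = 8 * ((xx m l - xx m j) * (1 - xx m j - xx m l)) := by
      rw [XX_eq, XX_eq]; ring
    rw [q, abs_mul, abs_mul, abs_of_pos hsum, XX_eq, abs_of_pos (by norm_num : (0:ℝ) < 8)]
    field_simp; ring
  have hr : (rval m t s j : ℝ) ≤ aa m t s j * Real.exp (Real.pi / m) := by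
    have h1 : 1 / aa m t s j ≤ Real.pi / m := by
      rw [div_le_div_iff₀ ap hm']
      have h5 : Kval m t s = aa m t s j * xx m j := by unfold aa; field_simp
      rw [h5, div_le_iff₀ hpi] at hK
      have : 0 < aa m t s j * Real.pi := by positivity
      nlinarith
    have h2 := Real.add_one_le_exp (Real.pi / m)
    have h3 : aa m t s j * (1 / aa m t s j + 1) ≤ aa m t s j * Real.exp (Real.pi / m) :=
      mul_le_mul_of_nonneg_left (by linarith) ap.le
    have h4 : aa m t s j * (1 / aa m t s j + 1) = aa m t s j + 1 := by field_simp; ring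
    linarith
  have hRinv : 1 / R ≤ Real.exp (4 * Real.pi * xx m j * (1 / |(l:ℝ) - j|)) / A := by
    rw [le_div_iff₀ g3]
    have h1 := Real.add_one_le_exp (4 * Real.pi * xx m j * (1 / |(l:ℝ) - j|))
    have h2 : 1 / R * A ≤ 1 / R * (R + 1) := mul_le_mul_of_nonneg_left g2 (by positivity)
    have h3 : 1 / R * (R + 1) = 1 + 1 / R := by field_simp
    have h4 : 4 * Real.pi * xx m j / |(l:ℝ) - j| = 4 * Real.pi * xx m j * (1 / |(l:ℝ) - j|) := by
      ring
    linarith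
  have hA2 : aa m t s j / A ≤ ((1 - XX m l) / |XX m j - XX m l|) * Real.exp (- xx m j) := by
    rw [hG, e2]
    have h1 := Real.add_one_le_exp (- xx m j)
    have h2 : (1 - xx m j - xx m l) ≤ (1 - xx m l) * Real.exp (- xx m j) := by
      have : (1 - xx m l) * (- xx m j + 1) ≤ (1 - xx m l) * Real.exp (- xx m j) :=
        mul_le_mul_of_nonneg_left h1 (by linarith)
      nlinarith
    have h3 : aa m t s j / (aa m t s j * |xx m l - xx m j| / xx m l)
        = xx m l * (1 - xx m j - xx m l) / (|xx m l - xx m j| * (1 - xx m j - xx m l)) := by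
      field_simp
    rw [h3, div_mul_eq_mul_div, mul_assoc (xx m l)]
    gcongr
  rw [e1]
  have e3 : Real.exp (Real.pi / m + 4 * Real.pi * xx m j * (1 / |(l:ℝ) - j|) - xx m j)
      = Real.exp (Real.pi / m) * Real.exp (4 * Real.pi * xx m j * (1 / |(l:ℝ) - j|))
        * Real.exp (- xx m j) := by
    rw [← Real.exp_add, ← Real.exp_add]; ring_nf
  rw [e3]
  calc (rval m t s j : ℝ) / R = rval m t s j * (1 / R) := by ring
    _ ≤ (aa m t s j * Real.exp (Real.pi / m)) *
        (Real.exp (4 * Real.pi * xx m j * (1 / |(l:ℝ) - j|)) / A) :=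
        mul_le_mul hr hRinv (by positivity) (by positivity)
    _ = (aa m t s j / A) * (Real.exp (Real.pi / m) *
        Real.exp (4 * Real.pi * xx m j * (1 / |(l:ℝ) - j|))) := by ring
    _ ≤ (((1 - XX m l) / |XX m j - XX m l|) * Real.exp (- xx m j)) * (Real.exp (Real.pi / m) *
        Real.exp (4 * Real.pi * xx m j * (1 / |(l:ℝ) - j|))) :=
        mul_le_mul_of_nonneg_right hA2 (by positivity)
    _ = _ := by ring

lemma harm (m : ℕ) : ∑ k ∈ Finset.Icc 1 m, 1 / (k:ℝ) ≤ 1 + Real.log m := by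
  have := harmonic_le_one_add_log m
  simp_rw [harmonic_eq_sum_Icc, Rat.cast_sum, Rat.cast_inv, Rat.cast_natCast] at this
  simpa using this

lemma dist_sum {m j : ℕ} (hj : j ∈ Finset.Icc 1 m) :
    ∑ l ∈ (Finset.Icc 1 m).erase j, 1 / |(l:ℝ) - j| ≤ 2 * (1 + Real.log m) := by
  rw [Finset.mem_Icc] at hj
  have hH := harm m
  have a1 : ∑ l ∈ Finset.Ico 1 j, 1 / |(l:ℝ) - j| ≤ ∑ k ∈ Finset.Icc 1 m, 1 / (k:ℝ) := by
    have inj : Set.InjOn (fun l => j - l) (Finset.Ico 1 j : Finset ℕ) := by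
      intro a ha b hb h
      simp at ha hb h; omega
    have : ∑ l ∈ Finset.Ico 1 j, 1 / |(l:ℝ) - j|
        = ∑ k ∈ (Finset.Ico 1 j).image (fun l => j - l), 1 / (k:ℝ) := by
      rw [Finset.sum_image inj]
      refine Finset.sum_congr rfl fun l hl => ?_
      rw [Finset.mem_Ico] at hl
      have hc : (l:ℝ) < j := by exact_mod_cast hl.2
      rw [abs_sub_comm, abs_of_pos (by linarith), Nat.cast_sub hl.2.le]
    rw [this]
    refine Finset.sum_le_sum_of_subset_of_nonneg ?_ (fun _ _ _ => by positivity)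
    intro k hk
    simp only [Finset.mem_image, Finset.mem_Ico] at hk
    obtain ⟨a, ha, rfl⟩ := hk
    rw [Finset.mem_Icc]; omega
  have a2 : ∑ l ∈ Finset.Ioc j m, 1 / |(l:ℝ) - j| ≤ ∑ k ∈ Finset.Icc 1 m, 1 / (k:ℝ) := by
    have inj : Set.InjOn (fun l => l - j) (Finset.Ioc j m : Finset ℕ) := by
      intro a ha b hb h
      simp at ha hb h; omega
    have : ∑ l ∈ Finset.Ioc j m, 1 / |(l:ℝ) - j|
        = ∑ k ∈ (Finset.Ioc j m).image (fun l => l - j), 1 / (k:ℝ) := by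
      rw [Finset.sum_image inj]
      refine Finset.sum_congr rfl fun l hl => ?_
      rw [Finset.mem_Ioc] at hl
      have hc : (j:ℝ) < l := by exact_mod_cast hl.1
      rw [abs_of_pos (by linarith), Nat.cast_sub hl.1.le]
    rw [this]
    refine Finset.sum_le_sum_of_subset_of_nonneg ?_ (fun _ _ _ => by positivity)
    intro k hk
    simp only [Finset.mem_image, Finset.mem_Ioc] at hk
    obtain ⟨a, ha, rfl⟩ := hk
    rw [Finset.mem_Icc]; omega
  have hsplit : (Finset.Icc 1 m).erase j = Finset.Ico 1 j ∪ Finset.Ioc j m := by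
    ext l; simp only [Finset.mem_erase, Finset.mem_Icc, Finset.mem_union, Finset.mem_Ico,
      Finset.mem_Ioc]; omega
  have hdis : Disjoint (Finset.Ico 1 j) (Finset.Ioc j m) := by
    rw [Finset.disjoint_left]; intro l h1 h2
    rw [Finset.mem_Ico] at h1; rw [Finset.mem_Ioc] at h2; omega
  rw [hsplit, Finset.sum_union hdis]
  linarith

lemma b_bound {m : ℕ} {t s : ℝ} {j : ℕ} (hj : j ∈ Finset.Icc 1 m) :
    |bval m t s j| ≤
      2 * Real.exp (Real.pi + (8 * Real.pi * Real.log (8 * Real.pi) + 1)) * (1 / j) := by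
  have hpi := Real.pi_pos
  have hm : 0 < m := by rw [Finset.mem_Icc] at hj; omega
  have hm1 : (1:ℝ) ≤ m := by exact_mod_cast hm
  have hm' : (0:ℝ) < m := by exact_mod_cast hm
  obtain ⟨x0, x1⟩ := xx_bounds hj
  have hj1 : (1:ℝ) ≤ j := by rw [Finset.mem_Icc] at hj; exact_mod_cast hj.1
  unfold bval
  rw [Finset.abs_prod]
  have h1 := Finset.prod_le_prod (s := (Finset.Icc 1 m).erase j)
    (f := fun l => |(1 - (rval m t s l : ℝ) / (rval m t s j : ℝ))⁻¹|)
    (fun l _ => abs_nonneg _)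
    (fun l hl => factor_bound (t := t) (s := s) hj (Finset.mem_erase.mp hl).2
      (Finset.mem_erase.mp hl).1)
  refine h1.trans ?_
  rw [Finset.prod_mul_distrib, ← Real.exp_sum]
  have hE : ∑ l ∈ (Finset.Icc 1 m).erase j,
      (Real.pi / m + 4 * Real.pi * xx m j * (1 / |(l:ℝ) - j|) - xx m j)
      ≤ Real.pi + (8 * Real.pi * Real.log (8 * Real.pi) + 1) := by
    rw [Finset.sum_sub_distrib, Finset.sum_add_distrib, ← Finset.mul_sum, Finset.sum_const,
      Finset.sum_const, Finset.card_erase_of_mem hj, Nat.card_Icc, nsmul_eq_mul, nsmul_eq_mul]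
    have hcast : ((m + 1 - 1 - 1 : ℕ) : ℝ) = m - 1 := by
      rw [Nat.add_sub_cancel, Nat.cast_sub hm]; simp
    rw [hcast]
    have hd := dist_sum hj
    have k1 : ((m:ℝ) - 1) * (Real.pi / m) ≤ Real.pi := by
      rw [← mul_div_assoc, div_le_iff₀ hm']; nlinarith
    have k2 : 4 * Real.pi * xx m j * ∑ l ∈ (Finset.Icc 1 m).erase j, 1 / |(l:ℝ) - j|
        ≤ 4 * Real.pi * xx m j * (2 * (1 + Real.log m)) :=
      mul_le_mul_of_nonneg_left hd (by positivity)
    have k3 : 8 * Real.pi * (1 + Real.log m) - (m - 1)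
        ≤ 8 * Real.pi * Real.log (8 * Real.pi) + 1 := by
      have := Real.log_le_sub_one_of_pos (show 0 < (m:ℝ) / (8 * Real.pi) by positivity)
      rw [Real.log_div hm'.ne' (by positivity)] at this
      have h2 := mul_le_mul_of_nonneg_left this (show 0 ≤ 8 * Real.pi by positivity)
      have h3 : 8 * Real.pi * ((m:ℝ) / (8 * Real.pi) - 1) = m - 8 * Real.pi := by
        field_simp
      rw [h3] at h2
      linarith
    have hD : 0 ≤ 8 * Real.pi * Real.log (8 * Real.pi) + 1 := by
      have : 0 ≤ Real.log (8 * Real.pi) := Real.log_nonneg (by linarith [Real.pi_gt_three])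
      positivity
    have k4 : xx m j * (8 * Real.pi * (1 + Real.log m) - (m - 1))
        ≤ 8 * Real.pi * Real.log (8 * Real.pi) + 1 := by
      refine (mul_le_mul_of_nonneg_left k3 x0.le).trans ?_
      nlinarith
    linarith
  refine (mul_le_mul (cheb_prod hj) (Real.exp_le_exp.mpr hE) (Real.exp_pos _).le
    (by positivity)).trans (le_of_eq ?_)
  ring

/-- for `m ≥ 2`: (i) there is an absolute constant `C > 0` with
`Σ_j |b_j| ≤ C·log m` and `r_j ≤ C·max{m³, m²·t/s}/j²` for all `j ∈ {1,…,m}`;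
(ii) `max_j s_j ≤ s`; and (iii) for every `f` that can be written as `f(x) = P(x) + R(x)`
at the points `x ∈ {0, s_1, …, s_m}` with `P` a real polynomial of degree at most `m−1`
and `R(0) = 0`, the m-term Richardson estimator `F = Σ_j b_j·f(s_j)` satisfies
`|F − f(0)| ≤ (Σ_j |b_j|)·max_j |R(s_j)|`. -/
theorem stmt5 :
    ∃ C : ℝ, 0 < C ∧ ∀ (m : ℕ) (hm : 2 ≤ m) (t s : ℝ), 0 < t → s ∈ Set.Ioo (0:ℝ) 1 →
      ((∑ j ∈ Finset.Icc 1 m, |bval m t s j| ≤ C * Real.log m) ∧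
        ∀ j ∈ Finset.Icc 1 m,
          (rval m t s j : ℝ) ≤ C * max ((m:ℝ)^3) ((m:ℝ)^2 * t / s) / (j:ℝ)^2) ∧
      (∀ j ∈ Finset.Icc 1 m, sval m t s j ≤ s) ∧
      (∀ (f R : ℝ → ℝ) (P : Polynomial ℝ), P.natDegree ≤ m - 1 → R 0 = 0 →
        f 0 = Polynomial.eval 0 P + R 0 →
        (∀ j ∈ Finset.Icc 1 m,
          f (sval m t s j) = Polynomial.eval (sval m t s j) P + R (sval m t s j)) →
        |(∑ j ∈ Finset.Icc 1 m, bval m t s j * f (sval m t s j)) - f 0|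
          ≤ (∑ j ∈ Finset.Icc 1 m, |bval m t s j|) *
            (Finset.Icc 1 m).sup' (Finset.nonempty_Icc.mpr (le_trans one_le_two hm))
              (fun j => |R (sval m t s j)|)) := by
  set D := 2 * Real.exp (Real.pi + (8 * Real.pi * Real.log (8 * Real.pi) + 1)) with hD
  have hDp : 0 < D := by positivity
  have hl2 : 0 < Real.log 2 := Real.log_pos (by norm_num)
  refine ⟨D * (1 + 1 / Real.log 2) + 33, by positivity, ?_⟩
  intro m hm t s ht hs
  have hm2 : (2:ℝ) ≤ m := by exact_mod_cast hm
  have hlm : Real.log 2 ≤ Real.log m := Real.log_le_log (by norm_num) hm2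
  refine ⟨⟨?_, ?_⟩, fun j hj => part_ii ht hs.1 hj, ?_⟩
  · calc ∑ j ∈ Finset.Icc 1 m, |bval m t s j|
        ≤ ∑ j ∈ Finset.Icc 1 m, D * (1 / (j:ℝ)) := Finset.sum_le_sum fun j hj => b_bound hj
      _ = D * ∑ j ∈ Finset.Icc 1 m, 1 / (j:ℝ) := by rw [Finset.mul_sum]
      _ ≤ D * (1 + Real.log m) := mul_le_mul_of_nonneg_left (harm m) hDp.le
      _ ≤ D * ((1 + 1 / Real.log 2) * Real.log m) := by
          apply mul_le_mul_of_nonneg_left _ hDp.le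
          have : 1 ≤ 1 / Real.log 2 * Real.log m := by
            rw [div_mul_eq_mul_div, one_mul, le_div_iff₀ hl2]; linarith
          linarith
      _ ≤ (D * (1 + 1 / Real.log 2) + 33) * Real.log m := by
          have : 0 < Real.log m := by linarith
          linarith
  · intro j hj
    refine (part_r ht hs.1 hj).trans ?_
    have : 0 ≤ D * (1 + 1 / Real.log 2) := by positivity
    gcongr
    linarith
  · intro f R P hP hR hf0 hf
    exact part_iii hm ht f R P hP hR hf0 hf
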